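/- arXiv:1802.07706 — 3 statements merged into one kernel-verified Lean document; each statement's English description precedes it below -/
import Mathlib

section
/- Let m, n ∈ ℝ with m² + n² ≠ 0. The complex roots of the characteristic polynomial of J(e₁^{mn}), where e₁^{mn} = (m, n, 0, 0, 0), are exactly 0, i√(m² + n²) and −i√(m² + n²); moreover 0 is a root of multiplicity 3. In particular, 0 is an eigenvalue of J(e₁^{mn}) of algebraic multiplicity 3. -/
open Polynomial Matrix

/-- The Jacobian matrix of the 5D Maxwell–Bloch vector field at x. -/
noncomputable def mbJacobian (x : Fin 5 → ℝ) : Matrix (Fin 5) (Fin 5) ℝ :=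
  !![0, 0, 1, 0, 0;
     0, 0, 0, 1, 0;
     x 4, 0, 0, 0, x 0;
     0, x 4, 0, 0, x 1;
     -(x 2), -(x 3), -(x 0), -(x 1), 0]

/-- The controlled Jacobian J(x,k) = J(x) - diag(k₁,...,k₅). -/
noncomputable def mbJacobianCtrl (x k : Fin 5 → ℝ) : Matrix (Fin 5) (Fin 5) ℝ :=
  mbJacobian x - Matrix.diagonal k

theorem charpoly_mbJacobian_e1 (m n : ℝ) :
    (mbJacobian ![m, n, 0, 0, 0]).charpoly = X ^ 3 * (X ^ 2 + C (m ^ 2 + n ^ 2)) := by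
  simp [mbJacobian, Matrix.charpoly, Matrix.charmatrix, Matrix.det_succ_row_zero,
    Fin.sum_univ_succ, Fin.succAbove, Matrix.diagonal_apply]
  ring

theorem roots_charpoly_e1 (m n : ℝ) (h : m ^ 2 + n ^ 2 ≠ 0) :
    (∀ z : ℂ,
      ((mbJacobian ![m, n, 0, 0, 0]).charpoly.map (algebraMap ℝ ℂ)).IsRoot z ↔
        z = 0 ∨ z = Complex.I * (Real.sqrt (m ^ 2 + n ^ 2) : ℂ) ∨
          z = -(Complex.I * (Real.sqrt (m ^ 2 + n ^ 2) : ℂ))) ∧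
    ((mbJacobian ![m, n, 0, 0, 0]).charpoly.map (algebraMap ℝ ℂ)).rootMultiplicity 0 = 3 := by
  have hmap : (mbJacobian ![m, n, 0, 0, 0]).charpoly.map (algebraMap ℝ ℂ) =
      (X ^ 2 + C ((m ^ 2 + n ^ 2 : ℝ) : ℂ)) * (X - C 0) ^ 3 := by
    rw [charpoly_mbJacobian_e1, mul_comm]
    simp
  have hsq : (Complex.I * (Real.sqrt (m ^ 2 + n ^ 2) : ℂ)) ^ 2 = -((m ^ 2 + n ^ 2 : ℝ) : ℂ) := by
    rw [mul_pow, Complex.I_sq, ← Complex.ofReal_pow, Real.sq_sqrt (by positivity), neg_one_mul]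
  have hroot : ¬ (X ^ 2 + C ((m ^ 2 + n ^ 2 : ℝ) : ℂ)).IsRoot 0 := by
    simpa [IsRoot.def] using mod_cast h
  rw [hmap]
  refine ⟨fun z => ?_, ?_⟩
  · rw [← sq_eq_sq_iff_eq_or_eq_neg, hsq, ← add_eq_zero_iff_eq_neg, or_comm]
    simp [IsRoot.def]
  · have hne : X ^ 2 + C ((m ^ 2 + n ^ 2 : ℝ) : ℂ) ≠ 0 := by
      intro h0
      exact hroot (h0 ▸ eval_zero)
    rw [rootMultiplicity_mul_X_sub_C_pow hne, rootMultiplicity_eq_zero hroot]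
end

section
/- Let k₁, …, k₅ > 0 and suppose either −(k₁ − k₃)²/4 < m < min{−(k₂ − k₄)²/4, k₁k₃} or −(k₂ − k₄)²/4 < m < min{−(k₁ − k₃)²/4, k₂k₄}. Then every eigenvalue λ of the controlled Jacobian J(e₂^m, k), where e₂^m = (0, 0, 0, 0, m), has negative real part; consequently |Arg λ| > απ/2 for every α ∈ (0, 1]. -/
open Polynomial Matrix

/-- The characteristic polynomial of the controlled Jacobian at `(0, 0, 0, 0, m)`. -/
theorem mbJacobianCtrl_e2_charpoly (m k₁ k₂ k₃ k₄ k₅ : ℝ) :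
    (mbJacobianCtrl ![0, 0, 0, 0, m] ![k₁, k₂, k₃, k₄, k₅]).charpoly =
      (X + C k₅) * ((X + C k₁) * (X + C k₃) - C m) * ((X + C k₂) * (X + C k₄) - C m) := by
  have h : (mbJacobianCtrl ![0, 0, 0, 0, m] ![k₁, k₂, k₃, k₄, k₅]).charmatrix =
      !![X + C k₁, 0, -1, 0, 0;
         0, X + C k₂, 0, -1, 0;
         -C m, 0, X + C k₃, 0, 0;
         0, -C m, 0, X + C k₄, 0;
         0, 0, 0, 0, X + C k₅] := by
    ext1 i j
    fin_cases i <;> fin_cases j <;>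
      simp [mbJacobianCtrl, mbJacobian, Matrix.sub_apply]
  rw [Matrix.charpoly, h]
  simp [Matrix.det_succ_row_zero, Fin.sum_univ_succ, Fin.succAbove]
  ring

/-- A root of a monic real quadratic with positive coefficients has negative real part. -/
theorem re_neg_of_shifted_mul_sub_eq_zero {a b m : ℝ} (ha : 0 < a) (hb : 0 < b)
    (hm : m < a * b) {z : ℂ} (hz : (z + a) * (z + b) - m = 0) : z.re < 0 := by
  have hre := congrArg Complex.re hz
  have him := congrArg Complex.im hz
  simp at hre him
  by_contra! hx
  have hy : z.im = 0 := by
    have : z.im * (2 * z.re + a + b) = 0 := by linarith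
    exact (mul_eq_zero.mp this).resolve_right (by positivity)
  rw [hy] at hre
  nlinarith [mul_nonneg hx hx, mul_nonneg hx ha.le, mul_nonneg hx hb.le]

theorem ctrl_e2_stable_case34 (m k₁ k₂ k₃ k₄ k₅ : ℝ)
    (h₁ : 0 < k₁) (h₂ : 0 < k₂) (h₃ : 0 < k₃) (h₄ : 0 < k₄) (h₅ : 0 < k₅)
    (hm : (-(k₁ - k₃) ^ 2 / 4 < m ∧ m < min (-(k₂ - k₄) ^ 2 / 4) (k₁ * k₃)) ∨
          (-(k₂ - k₄) ^ 2 / 4 < m ∧ m < min (-(k₁ - k₃) ^ 2 / 4) (k₂ * k₄))) :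
    ∀ lam : ℂ,
      ((mbJacobianCtrl ![0, 0, 0, 0, m] ![k₁, k₂, k₃, k₄, k₅]).charpoly.map
        (algebraMap ℝ ℂ)).IsRoot lam →
      lam.re < 0 ∧ ∀ α : ℝ, 0 < α → α ≤ 1 → α * Real.pi / 2 < |lam.arg| := by
  intro lam hroot
  have hm₀ : m < 0 := by
    rcases hm with ⟨-, h⟩ | ⟨-, h⟩
    · nlinarith [(lt_min_iff.mp h).1, sq_nonneg (k₂ - k₄)]
    · nlinarith [(lt_min_iff.mp h).1, sq_nonneg (k₁ - k₃)]
  have hre : lam.re < 0 := by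
    rw [mbJacobianCtrl_e2_charpoly] at hroot
    simp only [IsRoot.def, Polynomial.map_mul, Polynomial.map_sub, Polynomial.map_add, map_X,
      map_C, eval_mul, eval_sub, eval_add, eval_X, eval_C, Complex.coe_algebraMap,
      mul_eq_zero] at hroot
    rcases hroot with (h | h) | h
    · have := congrArg Complex.re h
      simp at this
      linarith
    · exact re_neg_of_shifted_mul_sub_eq_zero h₁ h₃ (hm₀.trans (mul_pos h₁ h₃)) h
    · exact re_neg_of_shifted_mul_sub_eq_zero h₂ h₄ (hm₀.trans (mul_pos h₂ h₄)) h
  refine ⟨hre, fun α _ hα => ?_⟩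
  have harg : Real.pi / 2 < |lam.arg| := by
    by_contra! h
    exact hre.not_ge (Complex.abs_arg_le_pi_div_two_iff.mp h)
  nlinarith [Real.pi_pos]
end

section
/- Let m, n ∈ ℝ with m² + n² ≠ 0, let k₁, k₂ > 0, k₃ = k₄ = b with 0 < b < 2√(m² + n²), and k₅ = 0. Then every eigenvalue λ of the controlled Jacobian J(e₁^{mn}, k) at e₁^{mn} = (m, n, 0, 0, 0) satisfies |Arg λ| > απ/2 for every α ∈ (0, 2/3). -/
open Polynomial Matrix

theorem mbJacobianCtrl_e1_charpoly (m n b k₁ k₂ : ℝ) :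
    (mbJacobianCtrl ![m, n, 0, 0, 0] ![k₁, k₂, b, b, 0]).charpoly =
      (X + C k₁) * (X + C k₂) * (X + C b) * (X ^ 2 + C b * X + C (m ^ 2 + n ^ 2)) := by
  have hchar : charmatrix (mbJacobianCtrl ![m, n, 0, 0, 0] ![k₁, k₂, b, b, 0]) =
      !![X + C k₁, 0, -1, 0, 0;
         0, X + C k₂, 0, -1, 0;
         0, 0, X + C b, 0, -C m;
         0, 0, 0, X + C b, -C n;
         0, 0, C m, C n, X] := by
    ext1 i j
    fin_cases i <;> fin_cases j <;> simp [mbJacobianCtrl, mbJacobian]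
  rw [Matrix.charpoly, hchar]
  simp [Matrix.det_succ_column_zero, Fin.sum_univ_succ, Fin.succAbove]
  ring

theorem Complex.re_neg_of_quadratic_eq_zero {b s : ℝ} (hb : 0 < b) (hs : 0 < s) {z : ℂ}
    (hz : z ^ 2 + b * z + s = 0) : z.re < 0 := by
  have hre := congrArg Complex.re hz
  have him := congrArg Complex.im hz
  simp only [pow_two, Complex.add_re, Complex.mul_re, Complex.ofReal_re, Complex.ofReal_im,
    Complex.zero_re, zero_mul, sub_zero] at hre
  simp only [pow_two, Complex.add_im, Complex.mul_im, Complex.ofReal_re, Complex.ofReal_im,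
    Complex.zero_im, zero_mul, add_zero] at him
  have hfactor : z.im * (2 * z.re + b) = 0 := by linarith
  rcases mul_eq_zero.mp hfactor with h | h
  · rw [h] at hre
    by_contra! hx
    nlinarith [mul_nonneg hb.le hx, mul_nonneg hx hx]
  · linarith

theorem Complex.re_neg_of_add_ofReal_eq_zero {k : ℝ} (hk : 0 < k) {z : ℂ}
    (hz : z + k = 0) : z.re < 0 := by
  have hre := congrArg Complex.re hz
  simp only [Complex.add_re, Complex.ofReal_re, Complex.zero_re] at hre
  linarith

theorem ctrl_e1_stable_b_small (m n b k₁ k₂ : ℝ)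
    (hmn : m ^ 2 + n ^ 2 ≠ 0) (h₁ : 0 < k₁) (h₂ : 0 < k₂)
    (hb0 : 0 < b) (hb : b < 2 * Real.sqrt (m ^ 2 + n ^ 2)) :
    ∀ lam : ℂ,
      ((mbJacobianCtrl ![m, n, 0, 0, 0] ![k₁, k₂, b, b, 0]).charpoly.map
        (algebraMap ℝ ℂ)).IsRoot lam →
      ∀ α : ℝ, 0 < α → α < 2 / 3 → α * Real.pi / 2 < |lam.arg| := by
  intro lam hroot α _ hα
  have hs : 0 < m ^ 2 + n ^ 2 := lt_of_le_of_ne (by positivity) hmn.symm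
  have hre : lam.re < 0 := by
    rw [mbJacobianCtrl_e1_charpoly] at hroot
    simp only [Polynomial.map_mul, Polynomial.map_add, Polynomial.map_pow, map_X, map_C,
      IsRoot.def, eval_mul, eval_add, eval_pow, eval_X, eval_C, mul_eq_zero,
      Complex.coe_algebraMap] at hroot
    rcases hroot with ((h | h) | h) | h
    · exact Complex.re_neg_of_add_ofReal_eq_zero h₁ h
    · exact Complex.re_neg_of_add_ofReal_eq_zero h₂ h
    · exact Complex.re_neg_of_add_ofReal_eq_zero hb0 h
    · exact Complex.re_neg_of_quadratic_eq_zero hb0 hs h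
  have harg : Real.pi / 2 < |lam.arg| := by
    rw [← not_le, Complex.abs_arg_le_pi_div_two_iff]
    exact not_le.mpr hre
  nlinarith [Real.pi_pos]
end
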